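/- Let n ≥ 1, 0 < α < 1, and let S ∈ C^{0,α}(∂Δ, ℂ^{n×n}) be such that S(ζ) is symmetric and the operator norm ‖S(ζ)‖ < 1 for every ζ ∈ ∂Δ. Let ζ₀, ξ₀ ∈ ∂Δ with ζ₀ ≠ ξ₀. If ψ ∈ O^{0,α}(∂Δ, ℂⁿ) satisfies ψ(ζ₀) = 0, ψ(ξ₀) = 0, and the map ∂Δ ∋ ζ ↦ conj(ψ(ζ)/ζ) + S(ζ)·(ψ(ζ)/ζ) belongs to O^{0,α}(∂Δ, ℂⁿ), then ψ ≡ 0. -/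

import Mathlib

open Set Metric

noncomputable section

/-- The open unit disc `Δ ⊂ ℂ`. -/
def uDisc : Set ℂ := Metric.ball 0 1
/-- The closed unit disc `Δ̄ ⊂ ℂ`. -/
def cDisc : Set ℂ := Metric.closedBall 0 1
/-- The unit circle `∂Δ ⊂ ℂ`. -/
def uCircle : Set ℂ := Metric.sphere 0 1

/-- `f` is of class `C^{k,β}` on `s`: continuous derivatives up to order `k` on `s`,
with `β`-Hölder `k`-th derivative. -/
def CkHolderOn {E F : Type*} [NormedAddCommGroup E] [NormedSpace ℝ E]
    [NormedAddCommGroup F] [NormedSpace ℝ F] (k : ℕ) (β : ℝ) (f : E → F) (s : Set E) : Prop :=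
  ContDiffOn ℝ k f s ∧
    ∃ C : NNReal, HolderOnWith C β.toNNReal (iteratedFDerivWithin ℝ k f s) s

/-- `f ∈ C^{k,β}(∂Δ, F)`: the `2π`-periodic parametrization `θ ↦ f(e^{iθ})` has continuous
derivatives up to order `k`, the `k`-th one being `β`-Hölder. -/
def CircleCk {F : Type*} [NormedAddCommGroup F] [NormedSpace ℝ F]
    (k : ℕ) (β : ℝ) (f : ℂ → F) : Prop :=
  CkHolderOn k β (fun θ : ℝ => f (Complex.exp ((θ : ℂ) * Complex.I))) univ

/-- `g ∈ O^{k,β}(∂Δ, F)`: `g` is holomorphic on `Δ` and of class `C^{k,β}` up to the boundary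
(`g` is identified with the extension to `Δ̄` of its boundary values). -/
def OHolder {F : Type*} [NormedAddCommGroup F] [NormedSpace ℂ F]
    (k : ℕ) (β : ℝ) (g : ℂ → F) : Prop :=
  DifferentiableOn ℂ g uDisc ∧ ContinuousOn g cDisc ∧ CkHolderOn k β g cDisc
/-- Componentwise complex conjugation on `ℂⁿ`. -/
def conjVecE {n : ℕ} (v : EuclideanSpace ℂ (Fin n)) : EuclideanSpace ℂ (Fin n) :=
  (EuclideanSpace.equiv (Fin n) ℂ).symm (fun j => (starRingEnd ℂ) (v j))

open Filter Topology MeasureTheory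
open scoped ComplexConjugate Real

lemma norm_one_sub_conj_mul {w z : ℂ} (hw : ‖w‖ = 1) : ‖1 - conj w * z‖ = ‖z - w‖ := by
  have h : conj w * w = 1 := by rw [Complex.conj_mul', hw]; simp
  have h2 : 1 - conj w * z = -(conj w * (z - w)) := by rw [mul_sub, h]; ring
  rw [h2, norm_neg, norm_mul, RCLike.norm_conj, hw, one_mul]

lemma one_sub_conj_mul_re_nonneg {w z : ℂ} (hw : ‖w‖ = 1) (hz : ‖z‖ ≤ 1) :
    0 ≤ (1 - conj w * z).re := by
  have h := Complex.re_le_norm (conj w * z)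
  rw [norm_mul, RCLike.norm_conj, hw, one_mul] at h
  rw [Complex.sub_re, Complex.one_re]
  linarith

lemma norm_le_norm_add_ofReal {a : ℂ} (ha : 0 ≤ a.re) {r : ℝ} (hr : 0 ≤ r) :
    ‖a‖ ≤ ‖a + r‖ := by
  rw [← sq_le_sq₀ (norm_nonneg _) (norm_nonneg _), Complex.sq_norm, Complex.sq_norm,
    Complex.normSq_apply, Complex.normSq_apply]
  simp only [Complex.add_re, Complex.ofReal_re, Complex.add_im, Complex.ofReal_im, add_zero]
  nlinarith

lemma le_norm_add_ofReal {a : ℂ} (ha : 0 ≤ a.re) (r : ℝ) : r ≤ ‖a + r‖ := by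
  have h := Complex.re_le_norm (a + r)
  simp only [Complex.add_re, Complex.ofReal_re] at h
  linarith

lemma add_ofReal_ne_zero {a : ℂ} (ha : 0 ≤ a.re) {r : ℝ} (hr : 0 < r) : a + r ≠ 0 :=
  norm_pos_iff.1 (hr.trans_le (le_norm_add_ofReal ha r))

lemma sq_one_sub_conj_mul {w z : ℂ} (hw : ‖w‖ = 1) (hz : ‖z‖ = 1) :
    (1 - conj w * z) ^ 2 = -(conj w * z) * (‖z - w‖ : ℂ) ^ 2 := by
  have h : conj w * w = 1 := by rw [Complex.conj_mul', hw]; simp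
  have h' : conj z * z = 1 := by rw [Complex.conj_mul', hz]; simp
  rw [← Complex.conj_mul', map_sub]
  linear_combination (conj w * z - conj w * w) * h' + (conj w * z - 1) * h

lemma div_re_pos {b c : ℂ} (hb : 0 ≤ b.re) (hb0 : b ≠ 0) (hc : 0 < c.re) (h : c.im = b.im) :
    0 < (b / c).re := by
  have hc0 : c ≠ 0 := by rintro rfl; simp at hc
  rw [Complex.div_re, h, ← add_div]
  refine div_pos ?_ (Complex.normSq_pos.2 hc0)
  by_cases hi : b.im = 0
  · have : b.re ≠ 0 := fun hr => hb0 (Complex.ext hr hi)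
    have : 0 < b.re := lt_of_le_of_ne hb this.symm
    rw [hi]; positivity
  · have := mul_self_pos.2 hi
    have := mul_nonneg hb hc.le
    linarith

lemma add_div_add_re_pos {a : ℂ} (ha : 0 ≤ a.re) {r s : ℝ} (hr : 0 ≤ r) (hs : 0 < s)
    (h0 : a + r ≠ 0) : 0 < ((a + r) / (a + s)).re := by
  refine div_re_pos ?_ h0 ?_ ?_
  · simp; linarith
  · simp; linarith
  · simp

lemma cos_mul_rpow_le_cpow_re {q : ℂ} (hq : 0 ≤ q.re) {τ : ℝ} (h0 : 0 < τ) (h1 : τ < 1) :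
    Real.cos (τ * (π / 2)) * ‖q‖ ^ τ ≤ (q ^ (τ : ℂ)).re := by
  rw [Complex.cpow_ofReal_re, mul_comm]
  refine mul_le_mul_of_nonneg_left ?_ (by positivity)
  have h := Complex.abs_arg_le_pi_div_two_iff.2 hq
  rw [← Real.cos_abs (q.arg * τ), abs_mul, abs_of_pos h0]
  have hpi := Real.pi_pos
  refine Real.cos_le_cos_of_nonneg_of_le_pi (by positivity) (by nlinarith) ?_
  rw [mul_comm]
  exact mul_le_mul_of_nonneg_left h h0.le

lemma circleIntegrable_norm_sub_rpow {w : ℂ} (hw : ‖w‖ = 1) {r : ℝ} (hr : -1 < r) :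
    CircleIntegrable (fun z => ‖z - w‖ ^ r) 0 1 := by
  rcases le_or_gt 0 r with h0 | h0
  · refine ContinuousOn.circleIntegrable' (Continuous.continuousOn ?_)
    exact (continuous_id.sub continuous_const).norm.rpow_const fun _ => Or.inr h0
  have hpi := Real.pi_pos
  have key : IntervalIntegrable (fun x : ℝ => (2 / π * |x|) ^ r) volume (-π) π := by
    have h1 : IntervalIntegrable (fun x : ℝ => (2 / π * |x|) ^ r) volume 0 π := by
      refine ((intervalIntegral.intervalIntegrable_rpow' hr (a := 0) (b := π)).const_mul
        ((2 / π) ^ r)).congr fun x hx => ?_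
      rw [Set.uIoc_of_le hpi.le] at hx
      simp only [abs_of_pos hx.1]
      rw [Real.mul_rpow (by positivity) hx.1.le]
    have h2 : IntervalIntegrable (fun x : ℝ => (2 / π * |x|) ^ r) volume (-π) 0 := by
      have h := h1.comp_sub_left 0
      simp only [zero_sub, abs_neg, sub_zero] at h
      exact h.symm
    exact h2.trans h1
  have hmeas : Measurable fun x : ℝ => ‖circleMap 0 1 x - w‖ ^ r :=
    (((continuous_circleMap 0 1).sub continuous_const).norm.measurable).pow_const r
  set φ := w.arg with hφ
  have hw' : w = circleMap 0 1 φ := by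
    have := Complex.norm_mul_exp_arg_mul_I w
    rw [hw] at this
    simpa [circleMap] using this.symm
  have hnorm : ∀ x : ℝ, ‖circleMap 0 1 (x + φ) - w‖ = |2 * Real.sin (x / 2)| := by
    intro x
    have : circleMap 0 1 (x + φ) - w = circleMap 0 1 φ * (Complex.exp (Complex.I * x) - 1) := by
      rw [hw']
      simp only [circleMap, zero_add, Complex.ofReal_one, one_mul, mul_sub, mul_one]
      rw [← Complex.exp_add]; push_cast; ring_nf
    rw [this, norm_mul, ← hw', hw, one_mul, Complex.norm_exp_I_mul_ofReal_sub_one,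
      Real.norm_eq_abs]
  have h3 : IntervalIntegrable (fun x : ℝ => ‖circleMap 0 1 (x + φ) - w‖ ^ r) volume (-π) π := by
    refine key.mono_fun' ?_ ?_
    · exact (hmeas.comp (measurable_id.add_const φ)).aestronglyMeasurable
    · refine (ae_restrict_iff' measurableSet_uIoc).2 (ae_of_all _ fun x hx => ?_)
      rw [Set.uIoc_of_le (by linarith)] at hx
      beta_reduce
      rw [Real.norm_of_nonneg (by positivity), hnorm]
      by_cases hx0 : x = 0
      · simp [hx0]
      refine Real.rpow_le_rpow_of_nonpos (by positivity) ?_ h0.le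
      have h := Real.mul_abs_le_abs_sin (x := x / 2) (by
        rw [abs_div, abs_two]; have := abs_le.2 ⟨hx.1.le, hx.2⟩; linarith)
      rw [abs_div, abs_two] at h
      rw [abs_mul, abs_two]
      linarith
  have h4 := h3.comp_sub_right φ
  simp only [sub_add_cancel] at h4
  refine Function.Periodic.intervalIntegrable (T := 2 * π) (t := -π + φ) ?_ (by positivity) ?_ _ _
  · intro x
    simp only [periodic_circleMap 0 1 x]
  · convert h4 using 1; ring

lemma norm_cpow_div_le {a : ℂ} (ha : 0 ≤ a.re) {r s τ : ℝ} (hr : 0 ≤ r) (hs : 0 < s)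
    (h0 : a ≠ 0) (hτ0 : 0 < τ) (hτ1 : τ < 1) :
    ‖((a + r) ^ 2)⁻¹ * ((a + r) / (a + s)) ^ (τ : ℂ)‖ ≤ (s ^ τ)⁻¹ * ‖a‖ ^ (τ - 2) := by
  have ha0 : 0 < ‖a‖ := norm_pos_iff.2 h0
  have h1 := norm_le_norm_add_ofReal ha hr
  have h2 := le_norm_add_ofReal ha s
  have h3 : 0 < ‖a + r‖ := ha0.trans_le h1
  have h4 : 0 < ‖a + s‖ := hs.trans_le h2
  rw [norm_mul, norm_inv, norm_pow, Complex.norm_cpow_real, norm_div,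
    Real.div_rpow h3.le h4.le]
  have h5 : (‖a + r‖ ^ 2)⁻¹ * (‖a + r‖ ^ τ / ‖a + s‖ ^ τ) =
      (‖a + s‖ ^ τ)⁻¹ * ‖a + r‖ ^ (τ - 2) := by
    rw [Real.rpow_sub h3, Real.rpow_two]; ring
  rw [h5]
  gcongr ?_ * ?_
  · gcongr
  · exact Real.rpow_le_rpow_of_nonpos ha0 h1 (by linarith)

lemma tendsto_one_div_add_atTop_complex (a : ℂ) :
    Tendsto (fun n : ℕ => a + ((1 / ((n : ℝ) + 1) : ℝ) : ℂ)) atTop (𝓝 a) := by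
  have h := (Complex.continuous_ofReal.tendsto 0).comp
    (tendsto_one_div_add_atTop_nhds_zero_nat (𝕜 := ℝ))
  simpa using h.const_add a

/-- The mean value property for a holomorphic function with a weak singularity at a boundary
point. -/
lemma circleAverage_weighted {w : ℂ} (hw : ‖w‖ = 1) {f : ℂ → ℂ}
    (hf : DiffContOnCl ℂ f (ball 0 1)) {C β τ s : ℝ} (hβ : 0 < β) (hτ0 : 0 < τ) (hτ1 : τ < 1)
    (hβτ : 1 < β + τ) (hs : 0 < s) (hC : ∀ z, ‖z‖ = 1 → ‖f z‖ ≤ C * ‖z - w‖ ^ β) :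
    CircleIntegrable (fun z => f z * (((1 - conj w * z) ^ 2)⁻¹ *
        ((1 - conj w * z) / (1 - conj w * z + s)) ^ (τ : ℂ))) 0 1 ∧
      Real.circleAverage (fun z => f z * (((1 - conj w * z) ^ 2)⁻¹ *
        ((1 - conj w * z) / (1 - conj w * z + s)) ^ (τ : ℂ))) 0 1 =
      f 0 * (1 / (1 + s)) ^ (τ : ℂ) := by
  have hfw : f w = 0 := by
    have h := hC w hw
    rw [sub_self, norm_zero, Real.zero_rpow hβ.ne', mul_zero] at h
    exact norm_le_zero_iff.1 h
  set a : ℂ → ℂ := fun z => 1 - conj w * z with ha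
  have hare : ∀ z, ‖z‖ ≤ 1 → 0 ≤ (a z).re := fun z hz => one_sub_conj_mul_re_nonneg hw hz
  have hnorm : ∀ z, ‖a z‖ = ‖z - w‖ := fun z => norm_one_sub_conj_mul hw
  have ha0 : ∀ z, z ≠ w → a z ≠ 0 := fun z hz => by
    rw [← norm_pos_iff, hnorm, norm_pos_iff]; exact sub_ne_zero.2 hz
  let F : ℝ → ℂ → ℂ := fun r z =>
    f z * (((a z + r) ^ 2)⁻¹ * ((a z + r) / (a z + s)) ^ (τ : ℂ))
  let G : ℂ → ℂ := fun z => f z * ((a z ^ 2)⁻¹ * (a z / (a z + s)) ^ (τ : ℂ))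
  let bd : ℂ → ℝ := fun z => C * (s ^ τ)⁻¹ * ‖z - w‖ ^ (β + τ - 2)
  have hcircle : ∀ x : ℝ, ‖circleMap 0 1 x‖ = 1 := fun x => by simp
  have hbdint : CircleIntegrable bd 0 1 :=
    (circleIntegrable_norm_sub_rpow hw (by linarith)).const_mul _
  have hC0 : 0 ≤ C := by
    have h := hC (-w) (by rwa [norm_neg])
    have h2 : 0 < ‖-w - w‖ ^ β := by
      apply Real.rpow_pos_of_pos
      rw [show -w - w = -(2 * w) by ring, norm_neg, norm_mul, hw]; norm_num
    exact nonneg_of_mul_nonneg_left ((norm_nonneg _).trans h) h2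
  have hbound : ∀ r : ℝ, 0 ≤ r → ∀ z, ‖z‖ = 1 → ‖F r z‖ ≤ bd z := by
    intro r hr z hz
    by_cases hzw : z = w
    · simp only [F, hzw, hfw, zero_mul, norm_zero, bd]
      positivity
    · have hpos : 0 < ‖z - w‖ := norm_pos_iff.2 (sub_ne_zero.2 hzw)
      have h1 := norm_cpow_div_le (hare z hz.le) hr hs (ha0 z hzw) hτ0 hτ1
      rw [hnorm] at h1
      calc ‖F r z‖ ≤ (C * ‖z - w‖ ^ β) * ((s ^ τ)⁻¹ * ‖z - w‖ ^ (τ - 2)) := by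
            simp only [F]; rw [norm_mul]; gcongr; exact hC z hz
        _ = bd z := by
            simp only [bd]; rw [show β + τ - 2 = β + (τ - 2) by ring, Real.rpow_add hpos]; ring
  have hdiff : ∀ r : ℝ, 0 < r → DiffContOnCl ℂ (F r) (ball 0 1) := by
    intro r hr
    have hne : ∀ z, ‖z‖ ≤ 1 → ∀ t : ℝ, 0 < t → a z + t ≠ 0 := fun z hz t ht =>
      add_ofReal_ne_zero (hare z hz) ht
    have hsl : ∀ z, ‖z‖ ≤ 1 → (a z + r) / (a z + s) ∈ Complex.slitPlane := fun z hz =>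
      Or.inl (add_div_add_re_pos (hare z hz) hr.le hs (hne z hz r hr))
    have had : ∀ t : ℝ, Differentiable ℂ fun z => a z + t := fun t => by fun_prop
    have hW : DifferentiableOn ℂ (fun z => ((a z + r) ^ 2)⁻¹ *
        ((a z + r) / (a z + s)) ^ (τ : ℂ)) (closedBall 0 1) := by
      intro z hz
      have hz1 : ‖z‖ ≤ 1 := by simpa using hz
      refine DifferentiableAt.differentiableWithinAt (DifferentiableAt.mul ?_ ?_)
      · exact (((had r) z).pow 2).inv (pow_ne_zero 2 (hne z hz1 r hr))
      · exact (((had r) z).div ((had s) z) (hne z hz1 s hs)).cpow (differentiableAt_const _)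
          (hsl z hz1)
    have hW' : DiffContOnCl ℂ (fun z => ((a z + r) ^ 2)⁻¹ *
        ((a z + r) / (a z + s)) ^ (τ : ℂ)) (ball 0 1) :=
      DifferentiableOn.diffContOnCl (by rwa [closure_ball _ one_ne_zero])
    exact hf.smul hW'
  have hmean : ∀ r : ℝ, 0 < r → Real.circleAverage (F r) 0 1 =
      f 0 * (((1 + r : ℂ) ^ 2)⁻¹ * ((1 + r) / (1 + s)) ^ (τ : ℂ)) := by
    intro r hr
    have h := DiffContOnCl.circleAverage (f := F r) (c := 0) (R := 1) (by simpa using hdiff r hr)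
    rw [h]; simp [F, ha]
  have hcont : ∀ r : ℝ, 0 < r → Continuous fun x : ℝ => F r (circleMap 0 1 x) := fun r hr => by
    have h := (hdiff r hr).continuousOn
    rw [closure_ball _ one_ne_zero] at h
    exact h.comp_continuous (continuous_circleMap 0 1) fun x => by simp
  have hlim : ∀ z, ‖z‖ = 1 →
      Tendsto (fun n : ℕ => F (1 / ((n : ℝ) + 1)) z) atTop (𝓝 (G z)) := by
    intro z hz
    by_cases hzw : z = w
    · simp only [F, G, hzw, hfw, zero_mul]; exact tendsto_const_nhds
    have hsl : a z / (a z + s) ∈ Complex.slitPlane := by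
      have h := add_div_add_re_pos (hare z hz.le) le_rfl hs (by simpa using ha0 z hzw)
      rw [Complex.ofReal_zero, add_zero] at h
      exact Or.inl h
    have h1 := tendsto_one_div_add_atTop_complex (a z)
    refine Tendsto.const_mul _ (Tendsto.mul ((h1.pow 2).inv₀ (pow_ne_zero 2 (ha0 z hzw))) ?_)
    exact (h1.div_const (a z + s)).cpow tendsto_const_nhds hsl
  have hpos : ∀ n : ℕ, 0 < 1 / ((n : ℝ) + 1) := fun n => Nat.one_div_pos_of_nat
  have hDCT := intervalIntegral.tendsto_integral_filter_of_dominated_convergence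
    (a := 0) (b := 2 * π) (μ := volume) (l := atTop)
    (F := fun (n : ℕ) (x : ℝ) => F (1 / ((n : ℝ) + 1)) (circleMap 0 1 x))
    (f := fun x => G (circleMap 0 1 x)) (fun x => bd (circleMap 0 1 x))
    (Eventually.of_forall fun n => (hcont _ (hpos n)).aestronglyMeasurable)
    (Eventually.of_forall fun n => ae_of_all _ fun x _ => hbound _ (hpos n).le _ (hcircle x))
    hbdint (ae_of_all _ fun x _ => hlim _ (hcircle x))
  have hGint : CircleIntegrable G 0 1 := by
    refine IntervalIntegrable.mono_fun' hbdint ?_ ?_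
    · exact aestronglyMeasurable_of_tendsto_ae atTop
        (fun n : ℕ => (hcont _ (hpos n)).aestronglyMeasurable)
        (ae_of_all _ fun x => hlim _ (hcircle x))
    · exact ae_of_all _ fun x => by
        simpa [F, G] using hbound 0 le_rfl _ (hcircle x)
  refine ⟨hGint, ?_⟩
  have hA : Tendsto (fun n : ℕ => Real.circleAverage (F (1 / ((n : ℝ) + 1))) 0 1) atTop
      (𝓝 (Real.circleAverage G 0 1)) := hDCT.const_smul _
  refine tendsto_nhds_unique hA ?_
  simp only [fun n : ℕ => hmean _ (hpos n)]
  have h1 := tendsto_one_div_add_atTop_complex 1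
  have hsl : (1 : ℂ) / (1 + s) ∈ Complex.slitPlane := by
    have h := add_div_add_re_pos (a := 1) (by simp) le_rfl hs (by simp)
    rw [Complex.ofReal_zero, add_zero] at h
    exact Or.inl h
  have h2 := (((h1.pow 2).inv₀ (by simp)).mul
    ((h1.div_const (1 + (s : ℂ))).cpow (tendsto_const_nhds (x := (τ : ℂ))) hsl)).const_mul (f 0)
  simpa using h2

/-- If the boundary values of `f` are close to `w * z * g z` with `g ≥ 0` near the boundary point
`w`, and `f` vanishes at `w` to some positive Hölder order, then `g` vanishes at `w` to second
order in the integral sense. -/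
lemma circleIntegrable_div_norm_sub_sq {w : ℂ} (hw : ‖w‖ = 1) {f : ℂ → ℂ}
    (hf : DiffContOnCl ℂ f (ball 0 1)) {g : ℂ → ℝ} {C β M B : ℝ} (hβ : 0 < β)
    (hC : ∀ z, ‖z‖ = 1 → ‖f z‖ ≤ C * ‖z - w‖ ^ β) (hM : ∀ z, ‖z‖ = 1 → ‖f z‖ ≤ M)
    (hg0 : ∀ z, ‖z‖ = 1 → 0 ≤ g z) (hgB : ∀ z, ‖z‖ = 1 → g z ≤ B)
    (hgc : Continuous fun x : ℝ => g (circleMap 0 1 x))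
    (hfg : ∀ ε > 0, ∃ ρ > 0, ∀ z, ‖z‖ = 1 → ‖z - w‖ < ρ → ‖f z - w * z * g z‖ ≤ ε * g z) :
    CircleIntegrable (fun z => g z / ‖z - w‖ ^ 2) 0 1 := by
  obtain ⟨τ, hτ0, hτ1, hβτ⟩ : ∃ τ : ℝ, 0 < τ ∧ τ < 1 ∧ 1 < β + τ := by
    refine ⟨max (1 / 2) (1 - β / 2), ?_, ?_, ?_⟩
    · exact lt_max_of_lt_left (by norm_num)
    · exact max_lt (by norm_num) (by linarith)
    · have := le_max_right (1 / 2) (1 - β / 2); linarith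
  have hpi := Real.pi_pos
  set c := Real.cos (τ * (π / 2)) with hc
  have hc0 : 0 < c := Real.cos_pos_of_mem_Ioo ⟨by nlinarith, by nlinarith⟩
  have hc1 : c ≤ 1 := Real.cos_le_one _
  obtain ⟨ρ, hρ, hnear⟩ := hfg (c / 2) (by positivity)
  have hww : conj w * w = 1 := by rw [Complex.conj_mul', hw]; simp
  have hM0 : 0 ≤ M := (norm_nonneg _).trans (hM w hw)
  have hB0 : 0 ≤ B := (hg0 w hw).trans (hgB w hw)
  set a : ℂ → ℂ := fun z => 1 - conj w * z with ha
  have hare : ∀ z, ‖z‖ ≤ 1 → 0 ≤ (a z).re := fun z hz => one_sub_conj_mul_re_nonneg hw hz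
  have hnorm : ∀ z, ‖a z‖ = ‖z - w‖ := fun z => norm_one_sub_conj_mul hw
  let s : ℕ → ℝ := fun n => 1 / ((n : ℝ) + 1)
  have hs : ∀ n, 0 < s n := fun n => Nat.one_div_pos_of_nat
  let Q : ℕ → ℂ → ℂ := fun n z => a z / (a z + s n)
  let F : ℕ → ℂ → ℂ := fun n z => f z * ((a z ^ 2)⁻¹ * Q n z ^ (τ : ℂ))
  have hF := fun n => circleAverage_weighted hw hf hβ hτ0 hτ1 hβτ (hs n) hC
  have hFi : ∀ n, CircleIntegrable (F n) 0 1 := fun n => (hF n).1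
  have hFa : ∀ n, Real.circleAverage (F n) 0 1 = f 0 * (1 / (1 + s n)) ^ (τ : ℂ) :=
    fun n => (hF n).2
  let K : ℝ := (M + B) / ρ ^ 2
  have hQ1 : ∀ n z, ‖z‖ = 1 → ‖Q n z‖ ≤ 1 := fun n z hz => by
    simp only [Q, norm_div]
    exact div_le_one_of_le₀ (norm_le_norm_add_ofReal (hare z hz.le) (hs n).le) (norm_nonneg _)
  have hQre : ∀ n z, ‖z‖ = 1 → 0 ≤ (Q n z).re := fun n z hz => by
    by_cases h0 : a z = 0
    · simp [Q, h0]
    · have h := add_div_add_re_pos (hare z hz.le) le_rfl (hs n) (by simpa using h0)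
      rw [Complex.ofReal_zero, add_zero] at h
      exact h.le
  let P : ℕ → ℂ → ℝ := fun n z => (-(conj w) ^ 2 * F n z).re
  let H : ℕ → ℂ → ℝ := fun n z => g z / ‖z - w‖ ^ 2 * ‖Q n z‖ ^ τ
  have hkey : ∀ n z, ‖z‖ = 1 → H n z ≤ 2 / c * (P n z + K) := by
    intro n z hz
    have hK0 : 0 ≤ K := by positivity
    by_cases hzw : z = w
    · subst hzw
      simp only [H, P, F, ha, hww, sub_self]
      simp only [norm_zero, ne_eq, OfNat.ofNat_ne_zero, not_false_eq_true, zero_pow, div_zero,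
        zero_mul, inv_zero, mul_zero, Complex.zero_re, zero_add]
      positivity
    have ht : 0 < ‖z - w‖ := norm_pos_iff.2 (sub_ne_zero.2 hzw)
    set t := ‖z - w‖ with htd
    have hzz : conj z * z = 1 := by rw [Complex.conj_mul', hz]; simp
    have hz0 : z ≠ 0 := by rintro rfl; simp at hz
    have hw0 : w ≠ 0 := by rintro rfl; simp at hw
    set R := Q n z ^ (τ : ℂ) with hR
    set u := conj w * conj z * f z with hu
    have hPe : -(conj w) ^ 2 * F n z = ((1 / t ^ 2 : ℝ) : ℂ) * (u * R) := by
      have hsq : a z ^ 2 = -(conj w * z) * (t : ℂ) ^ 2 := sq_one_sub_conj_mul hw hz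
      have htc : (t : ℂ) ≠ 0 := by exact_mod_cast ht.ne'
      have hcw : conj w ≠ 0 := by simpa using hw0
      simp only [F]
      rw [hsq, hu, ← hR, eq_inv_of_mul_eq_one_left hzz]
      push_cast
      field_simp
    have hRn : ‖R‖ = ‖Q n z‖ ^ τ := Complex.norm_cpow_real _ _
    have hRre : c * ‖R‖ ≤ R.re := by
      rw [hRn]; exact cos_mul_rpow_le_cpow_re (hQre n z hz) hτ0 hτ1
    have hR1 : ‖R‖ ≤ 1 := by
      rw [hRn]; exact Real.rpow_le_one (norm_nonneg _) (hQ1 n z hz) hτ0.le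
    have hun : ‖u‖ = ‖f z‖ := by
      rw [hu, norm_mul, norm_mul, RCLike.norm_conj, RCLike.norm_conj, hw, hz]; ring
    have hP : P n z = 1 / t ^ 2 * (u * R).re := by
      simp only [P]; rw [hPe, Complex.re_ofReal_mul]
    have hH : H n z = 1 / t ^ 2 * (g z * ‖R‖) := by
      simp only [H]; rw [hRn]; ring
    have hg := hg0 z hz
    suffices h : c / 2 * H n z ≤ P n z + K by
      calc H n z = 2 / c * (c / 2 * H n z) := by field_simp
        _ ≤ _ := by gcongr
    rcases lt_or_ge t ρ with hlt | hge
    · have h1 := hnear z hz hlt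
      have h2 : ‖u - g z‖ ≤ c / 2 * g z := by
        have : u - g z = conj w * conj z * (f z - w * z * g z) := by
          rw [hu]
          linear_combination (g z : ℂ) * hww * (conj z * z) + (g z : ℂ) * hzz
        rw [this, norm_mul, norm_mul, RCLike.norm_conj, RCLike.norm_conj, hw, hz]
        simpa using h1
      have h3 : (u * R).re = g z * R.re + ((u - g z) * R).re := by
        rw [← Complex.re_ofReal_mul, ← Complex.add_re]; ring_nf
      have h4 : -(c / 2 * g z * ‖R‖) ≤ ((u - g z) * R).re := by
        have h5 := Complex.abs_re_le_norm ((u - g z) * R)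
        rw [norm_mul] at h5
        have h6 := mul_le_mul_of_nonneg_right h2 (norm_nonneg R)
        have h7 := neg_abs_le ((u - g z) * R).re
        linarith
      have h8 : c / 2 * (g z * ‖R‖) ≤ (u * R).re := by
        have := mul_le_mul_of_nonneg_left hRre hg
        rw [h3]; linarith
      rw [hP, hH]
      have : 1 / t ^ 2 * (c / 2 * (g z * ‖R‖)) ≤ 1 / t ^ 2 * (u * R).re := by gcongr
      linarith
    · have h1 : 1 / t ^ 2 ≤ 1 / ρ ^ 2 := by gcongr
      have h2 : -M ≤ (u * R).re := by
        have h5 := Complex.abs_re_le_norm (u * R)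
        rw [norm_mul, hun] at h5
        have h6 : ‖f z‖ * ‖R‖ ≤ M * 1 :=
          mul_le_mul (hM z hz) hR1 (norm_nonneg _) hM0
        have h7 := neg_abs_le (u * R).re
        linarith
      have h3 : g z * ‖R‖ ≤ B := by
        have := mul_le_mul (hgB z hz) hR1 (norm_nonneg _) hB0
        linarith
      have h4 : c / 2 * (g z * ‖R‖) ≤ B := by
        have : 0 ≤ g z * ‖R‖ := by positivity
        nlinarith
      have h5 : c / 2 * (g z * ‖R‖) - (u * R).re ≤ M + B := by linarith
      have h6 : 1 / t ^ 2 * (c / 2 * (g z * ‖R‖) - (u * R).re) ≤ 1 / ρ ^ 2 * (M + B) :=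
        (mul_le_mul_of_nonneg_left h5 (by positivity)).trans
          (mul_le_mul_of_nonneg_right h1 (by positivity))
      have h7 : K = 1 / ρ ^ 2 * (M + B) := by simp only [K]; ring
      rw [hP, hH, h7]
      linarith
  have hcircle : ∀ x : ℝ, ‖circleMap 0 1 x‖ = 1 := fun x => by simp
  have hH0 : ∀ n z, ‖z‖ = 1 → 0 ≤ H n z := fun n z hz =>
    mul_nonneg (div_nonneg (hg0 z hz) (by positivity)) (by positivity)
  have hHmeas : ∀ n, Measurable fun x : ℝ => H n (circleMap 0 1 x) := by
    intro n
    have hcm := (continuous_circleMap (0 : ℂ) 1).measurable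
    have ham : Measurable fun x : ℝ => a (circleMap 0 1 x) :=
      measurable_const.sub (measurable_const.mul hcm)
    exact (hgc.measurable.div ((hcm.sub_const w).norm.pow_const 2)).mul
      ((ham.div (ham.add_const _)).norm.pow_const τ)
  have hlim : ∀ z, ‖z‖ = 1 →
      Tendsto (fun n => H n z) atTop (𝓝 (g z / ‖z - w‖ ^ 2)) := by
    intro z hz
    by_cases hzw : z = w
    · simp [H, hzw]
    have h0 : a z ≠ 0 := by
      rw [← norm_pos_iff, hnorm, norm_pos_iff]; exact sub_ne_zero.2 hzw
    have h1 : Tendsto (fun n => Q n z) atTop (𝓝 (a z / a z)) :=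
      tendsto_const_nhds.div (tendsto_one_div_add_atTop_complex (a z)) h0
    rw [div_self h0] at h1
    have h2 := (h1.norm.rpow_const (p := τ) (by simp)).const_mul (g z / ‖z - w‖ ^ 2)
    simpa using h2
  have h2pi : (0 : ℝ) ≤ 2 * π := by positivity
  have hint : ∀ n, ∫⁻ x in Set.Ioc 0 (2 * π), ‖H n (circleMap 0 1 x)‖ₑ ≤
      ENNReal.ofReal (2 / c * ((2 * π) * (‖f 0‖ + K))) := by
    intro n
    have hPi : IntervalIntegrable (fun x : ℝ => -(conj w) ^ 2 * F n (circleMap 0 1 x))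
      volume 0 (2 * π) := (hFi n).const_mul _
    have hPi' : IntegrableOn (fun x : ℝ => -(conj w) ^ 2 * F n (circleMap 0 1 x))
      (Set.Ioc 0 (2 * π)) := (intervalIntegrable_iff_integrableOn_Ioc_of_le h2pi).1 hPi
    have hPr : IntegrableOn (fun x : ℝ => P n (circleMap 0 1 x)) (Set.Ioc 0 (2 * π)) := hPi'.re
    have hUi : IntegrableOn (fun x : ℝ => 2 / c * (P n (circleMap 0 1 x) + K))
      (Set.Ioc 0 (2 * π)) :=
      (hPr.add (integrableOn_const measure_Ioc_lt_top.ne)).const_mul _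
    have hPint : ∫ x in Set.Ioc 0 (2 * π), P n (circleMap 0 1 x) ≤ 2 * π * ‖f 0‖ := by
      have h1 : ∫ x in Set.Ioc 0 (2 * π), P n (circleMap 0 1 x) =
          (∫ x in Set.Ioc 0 (2 * π), -(conj w) ^ 2 * F n (circleMap 0 1 x)).re :=
        integral_re hPi'
      have h2 : ∫ x in Set.Ioc 0 (2 * π), F n (circleMap 0 1 x) =
          (2 * π : ℝ) • (f 0 * (1 / (1 + s n)) ^ (τ : ℂ)) := by
        rw [← hFa n, Real.circleAverage_def, smul_smul, mul_inv_cancel₀ (by positivity), one_smul,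
          intervalIntegral.integral_of_le h2pi]
      rw [h1, integral_const_mul, h2]
      refine (Complex.re_le_norm _).trans ?_
      rw [norm_mul, norm_neg, norm_pow, RCLike.norm_conj, hw, norm_smul, norm_mul (f 0),
        Complex.norm_cpow_real, Real.norm_of_nonneg h2pi, one_pow, one_mul]
      have h3 : ‖(1 : ℂ) / (1 + s n)‖ ≤ 1 := by
        rw [norm_div]
        exact div_le_one_of_le₀ (norm_le_norm_add_ofReal (by simp) (hs n).le) (norm_nonneg _)
      have h4 := Real.rpow_le_one (norm_nonneg _) h3 hτ0.le
      have h5 := mul_le_of_le_one_right (norm_nonneg (f 0)) h4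
      gcongr
    calc ∫⁻ x in Set.Ioc 0 (2 * π), ‖H n (circleMap 0 1 x)‖ₑ
        ≤ ∫⁻ x in Set.Ioc 0 (2 * π), ENNReal.ofReal (2 / c * (P n (circleMap 0 1 x) + K)) := by
          refine lintegral_mono fun x => ?_
          rw [Real.enorm_of_nonneg (hH0 n _ (hcircle x))]
          exact ENNReal.ofReal_le_ofReal (hkey n _ (hcircle x))
      _ = ENNReal.ofReal (∫ x in Set.Ioc 0 (2 * π), 2 / c * (P n (circleMap 0 1 x) + K)) :=
          (ofReal_integral_eq_lintegral_ofReal hUi (ae_of_all _ fun x =>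
            (hH0 n _ (hcircle x)).trans (hkey n _ (hcircle x)))).symm
      _ ≤ _ := by
          refine ENNReal.ofReal_le_ofReal ?_
          rw [integral_const_mul, integral_add hPr (integrableOn_const measure_Ioc_lt_top.ne),
            setIntegral_const]
          gcongr
          simp only [Measure.real, Real.volume_Ioc, sub_zero, ENNReal.toReal_ofReal h2pi,
            smul_eq_mul]
          linarith
  refine (intervalIntegrable_iff_integrableOn_Ioc_of_le h2pi).2 ?_
  refine integrable_of_tendsto (G := fun n x => H n (circleMap 0 1 x))
    (ae_of_all _ fun x => hlim _ (hcircle x)) (fun n => (hHmeas n).aestronglyMeasurable) ?_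
  exact ne_top_of_le_ne_top ENNReal.ofReal_ne_top
    (liminf_le_of_frequently_le' (Frequently.of_forall hint))

/-- A function on the closed disc, holomorphic inside, whose boundary values divided by `z` have
nonnegative real part and which vanishes to second order, in the integral sense, at two boundary
points: the real part in question is identically zero. -/
lemma re_inv_mul_eq_zero {w₁ w₂ : ℂ} (hw₁ : ‖w₁‖ = 1) (hw₂ : ‖w₂‖ = 1) (hne : w₁ ≠ w₂)
    {H : ℂ → ℂ} (hH : DiffContOnCl ℂ H (ball 0 1)) {g : ℂ → ℝ} {C : ℝ}
    (hHg : ∀ z, ‖z‖ = 1 → ‖H z‖ ≤ C * g z)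
    (hg₁ : CircleIntegrable (fun z => g z / ‖z - w₁‖ ^ 2) 0 1)
    (hg₂ : CircleIntegrable (fun z => g z / ‖z - w₂‖ ^ 2) 0 1)
    (hH₁ : H w₁ = 0) (hH₂ : H w₂ = 0) (hre : ∀ z, ‖z‖ = 1 → 0 ≤ (z⁻¹ * H z).re) :
    ∀ z, ‖z‖ = 1 → (z⁻¹ * H z).re = 0 := by
  have h2pi : (0 : ℝ) ≤ 2 * π := by positivity
  have hcircle : ∀ x : ℝ, ‖circleMap 0 1 x‖ = 1 := fun x => by simp
  set d := ‖w₁ - w₂‖ with hd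
  have hd0 : 0 < d := norm_pos_iff.2 (sub_ne_zero.2 hne)
  set a : ℂ → ℂ → ℂ := fun w z => 1 - conj w * z with ha
  have hare : ∀ w z, ‖w‖ = 1 → ‖z‖ ≤ 1 → 0 ≤ (a w z).re :=
    fun w z hw hz => one_sub_conj_mul_re_nonneg hw hz
  let bd : ℂ → ℝ := fun z => C * (4 / d ^ 2) * (g z / ‖z - w₁‖ ^ 2 + g z / ‖z - w₂‖ ^ 2)
  let F : ℝ → ℂ → ℂ := fun r z => z * H z * (((a w₁ z + r) ^ 2)⁻¹ * ((a w₂ z + r) ^ 2)⁻¹)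
  let k : ℂ → ℝ := fun z => (z⁻¹ * H z).re / (‖z - w₁‖ ^ 2 * ‖z - w₂‖ ^ 2)
  have hbdint : CircleIntegrable bd 0 1 :=
    IntervalIntegrable.const_mul (IntervalIntegrable.add hg₁ hg₂) _
  have hCg : ∀ z, ‖z‖ = 1 → 0 ≤ C * g z := fun z hz => (norm_nonneg _).trans (hHg z hz)
  have hbound : ∀ r : ℝ, 0 ≤ r → ∀ z, ‖z‖ = 1 → ‖F r z‖ ≤ bd z := by
    intro r hr z hz
    have hbd0 : 0 ≤ bd z := by
      have : bd z = 4 / d ^ 2 * (C * g z / ‖z - w₁‖ ^ 2 + C * g z / ‖z - w₂‖ ^ 2) := by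
        simp only [bd]; ring
      rw [this]
      have := hCg z hz
      positivity
    by_cases h1 : z = w₁
    · rw [h1] at hbd0 ⊢; simpa [F, hH₁] using hbd0
    by_cases h2 : z = w₂
    · rw [h2] at hbd0 ⊢; simpa [F, hH₂] using hbd0
    have ht₁ : 0 < ‖z - w₁‖ := norm_pos_iff.2 (sub_ne_zero.2 h1)
    have ht₂ : 0 < ‖z - w₂‖ := norm_pos_iff.2 (sub_ne_zero.2 h2)
    have hn₁ : ‖z - w₁‖ ≤ ‖a w₁ z + r‖ := by
      rw [← norm_one_sub_conj_mul hw₁]; exact norm_le_norm_add_ofReal (hare _ _ hw₁ hz.le) hr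
    have hn₂ : ‖z - w₂‖ ≤ ‖a w₂ z + r‖ := by
      rw [← norm_one_sub_conj_mul hw₂]; exact norm_le_norm_add_ofReal (hare _ _ hw₂ hz.le) hr
    have htri : d ≤ ‖z - w₁‖ + ‖z - w₂‖ := by
      have : w₁ - w₂ = -(z - w₁) + (z - w₂) := by ring
      rw [hd, this]
      exact (norm_add_le _ _).trans (by rw [norm_neg])
    have hsum : d ^ 2 ≤ 4 * (‖z - w₁‖ ^ 2 + ‖z - w₂‖ ^ 2) := by
      nlinarith [sq_nonneg (‖z - w₁‖ - ‖z - w₂‖)]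
    calc ‖F r z‖ ≤ C * g z * ((‖z - w₁‖ ^ 2)⁻¹ * (‖z - w₂‖ ^ 2)⁻¹) := by
          simp only [F]
          rw [norm_mul, norm_mul, norm_mul, hz, one_mul, norm_inv, norm_inv, norm_pow, norm_pow]
          gcongr
          · exact hCg z hz
          · exact hHg z hz
      _ ≤ C * g z * ((‖z - w₁‖ ^ 2)⁻¹ * (‖z - w₂‖ ^ 2)⁻¹ *
            (4 * (‖z - w₁‖ ^ 2 + ‖z - w₂‖ ^ 2) / d ^ 2)) := by
          refine mul_le_mul_of_nonneg_left ?_ (hCg z hz)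
          refine le_mul_of_one_le_right (by positivity) ?_
          rwa [one_le_div (by positivity)]
      _ = bd z := by simp only [bd]; field_simp; ring
  have hdiff : ∀ r : ℝ, 0 < r → DiffContOnCl ℂ (F r) (ball 0 1) := by
    intro r hr
    have hW : DifferentiableOn ℂ (fun z => ((a w₁ z + r) ^ 2)⁻¹ * ((a w₂ z + r) ^ 2)⁻¹)
        (closedBall 0 1) := by
      intro z hz
      have hz1 : ‖z‖ ≤ 1 := by simpa using hz
      have had : ∀ w, Differentiable ℂ fun z => (a w z + r) ^ 2 := fun w => by fun_prop
      refine DifferentiableAt.differentiableWithinAt (DifferentiableAt.mul ?_ ?_)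
      · exact ((had w₁) z).inv (pow_ne_zero 2 (add_ofReal_ne_zero (hare _ _ hw₁ hz1) hr))
      · exact ((had w₂) z).inv (pow_ne_zero 2 (add_ofReal_ne_zero (hare _ _ hw₂ hz1) hr))
    have hW' : DiffContOnCl ℂ (fun z => ((a w₁ z + r) ^ 2)⁻¹ * ((a w₂ z + r) ^ 2)⁻¹)
        (ball 0 1) := DifferentiableOn.diffContOnCl (by rwa [closure_ball _ one_ne_zero])
    exact ((differentiable_id.diffContOnCl).smul hH).smul hW'
  have hmean : ∀ r : ℝ, 0 < r → ∫ x in 0..2 * π, F r (circleMap 0 1 x) = 0 := by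
    intro r hr
    have h := DiffContOnCl.circleAverage (f := F r) (c := 0) (R := 1) (by simpa using hdiff r hr)
    have h0 : F r 0 = 0 := by simp [F]
    rw [h0, Real.circleAverage_def, smul_eq_zero] at h
    exact h.resolve_left (by positivity)
  have hcont : ∀ r : ℝ, 0 < r → Continuous fun x : ℝ => F r (circleMap 0 1 x) := fun r hr => by
    have h := (hdiff r hr).continuousOn
    rw [closure_ball _ one_ne_zero] at h
    exact h.comp_continuous (continuous_circleMap 0 1) fun x => by simp
  have hlim : ∀ z, ‖z‖ = 1 →
      Tendsto (fun n : ℕ => F (1 / ((n : ℝ) + 1)) z) atTop (𝓝 (F 0 z)) := by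
    intro z hz
    by_cases h1 : z = w₁
    · simp only [F, h1, hH₁, mul_zero, zero_mul]; exact tendsto_const_nhds
    by_cases h2 : z = w₂
    · simp only [F, h2, hH₂, mul_zero, zero_mul]; exact tendsto_const_nhds
    have hne : ∀ w, ‖w‖ = 1 → z ≠ w → a w z ≠ 0 := fun w hw hzw => by
      rw [← norm_pos_iff, norm_one_sub_conj_mul hw, norm_pos_iff]; exact sub_ne_zero.2 hzw
    simp only [F, Complex.ofReal_zero, add_zero]
    refine Tendsto.const_mul _ (Tendsto.mul ?_ ?_)
    · exact ((tendsto_one_div_add_atTop_complex (a w₁ z)).pow 2).inv₀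
        (pow_ne_zero 2 (hne _ hw₁ h1))
    · exact ((tendsto_one_div_add_atTop_complex (a w₂ z)).pow 2).inv₀
        (pow_ne_zero 2 (hne _ hw₂ h2))
  have hpos : ∀ n : ℕ, 0 < 1 / ((n : ℝ) + 1) := fun n => Nat.one_div_pos_of_nat
  have hDCT := intervalIntegral.tendsto_integral_filter_of_dominated_convergence
    (a := 0) (b := 2 * π) (μ := volume) (l := atTop)
    (F := fun (n : ℕ) (x : ℝ) => F (1 / ((n : ℝ) + 1)) (circleMap 0 1 x))
    (f := fun x => F 0 (circleMap 0 1 x)) (fun x => bd (circleMap 0 1 x))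
    (Eventually.of_forall fun n => (hcont _ (hpos n)).aestronglyMeasurable)
    (Eventually.of_forall fun n => ae_of_all _ fun x _ => hbound _ (hpos n).le _ (hcircle x))
    hbdint (ae_of_all _ fun x _ => hlim _ (hcircle x))
  have hF0 : ∫ x in 0..2 * π, F 0 (circleMap 0 1 x) = 0 := by
    refine tendsto_nhds_unique hDCT ?_
    simp only [fun n : ℕ => hmean _ (hpos n)]
    exact tendsto_const_nhds
  have hF0int : IntervalIntegrable (fun x : ℝ => F 0 (circleMap 0 1 x)) volume 0 (2 * π) := by
    refine IntervalIntegrable.mono_fun' hbdint ?_ ?_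
    · exact aestronglyMeasurable_of_tendsto_ae atTop
        (fun n : ℕ => (hcont _ (hpos n)).aestronglyMeasurable)
        (ae_of_all _ fun x => hlim _ (hcircle x))
    · exact ae_of_all _ fun x => hbound 0 le_rfl _ (hcircle x)
  have hk : ∀ z, ‖z‖ = 1 → k z = (conj w₁ * conj w₂ * F 0 z).re := by
    intro z hz
    by_cases h1 : z = w₁
    · simp [k, F, h1, hH₁]
    by_cases h2 : z = w₂
    · simp [k, F, h2, hH₂]
    have ht₁ : (‖z - w₁‖ : ℂ) ≠ 0 := by
      exact_mod_cast (norm_pos_iff.2 (sub_ne_zero.2 h1)).ne'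
    have ht₂ : (‖z - w₂‖ : ℂ) ≠ 0 := by
      exact_mod_cast (norm_pos_iff.2 (sub_ne_zero.2 h2)).ne'
    have hz0 : z ≠ 0 := by rintro rfl; simp at hz
    have hc₁ : conj w₁ ≠ 0 := by
      rw [← norm_pos_iff, RCLike.norm_conj, hw₁]; exact one_pos
    have hc₂ : conj w₂ ≠ 0 := by
      rw [← norm_pos_iff, RCLike.norm_conj, hw₂]; exact one_pos
    have hkc : k z = ((1 / (‖z - w₁‖ ^ 2 * ‖z - w₂‖ ^ 2) : ℝ) * (z⁻¹ * H z)).re := by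
      rw [Complex.re_ofReal_mul]; simp only [k]; ring
    have hs₁ : a w₁ z ^ 2 = _ := sq_one_sub_conj_mul hw₁ hz
    have hs₂ : a w₂ z ^ 2 = _ := sq_one_sub_conj_mul hw₂ hz
    rw [hkc]
    congr 1
    simp only [F, Complex.ofReal_zero, add_zero]
    rw [hs₁, hs₂]
    push_cast
    field_simp
  have hcF : IntegrableOn (fun x : ℝ => conj w₁ * conj w₂ * F 0 (circleMap 0 1 x))
      (Set.Ioc 0 (2 * π)) :=
    (intervalIntegrable_iff_integrableOn_Ioc_of_le h2pi).1 (hF0int.const_mul _)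
  have hkint : IntegrableOn (fun x : ℝ => k (circleMap 0 1 x)) (Set.Ioc 0 (2 * π)) := by
    refine Integrable.congr hcF.re (ae_of_all _ fun x => ?_)
    exact (hk _ (hcircle x)).symm
  have hk0 : ∫ x in Set.Ioc 0 (2 * π), k (circleMap 0 1 x) = 0 := by
    simp only [fun x : ℝ => hk _ (hcircle x)]
    have hF0' : ∫ x in Set.Ioc 0 (2 * π), F 0 (circleMap 0 1 x) = 0 := by
      rw [← intervalIntegral.integral_of_le h2pi]; exact hF0
    have h := integral_re hcF
    rw [integral_const_mul, hF0', mul_zero] at h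
    simpa using h
  have hkae := (integral_eq_zero_iff_of_nonneg
    (fun x => div_nonneg (hre _ (hcircle x)) (by positivity)) hkint).1 hk0
  have hae : (fun x : ℝ => ((circleMap 0 1 x)⁻¹ * H (circleMap 0 1 x)).re)
      =ᵐ[volume.restrict (Set.Icc 0 (2 * π))] fun _ => 0 := by
    rw [restrict_Ioc_eq_restrict_Icc.symm]
    filter_upwards [hkae] with x hx
    by_cases h1 : circleMap 0 1 x = w₁
    · simp [h1, hH₁]
    by_cases h2 : circleMap 0 1 x = w₂
    · simp [h2, hH₂]
    have ht₁ := norm_ne_zero_iff.2 (sub_ne_zero.2 h1)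
    have ht₂ := norm_ne_zero_iff.2 (sub_ne_zero.2 h2)
    simp only [Pi.zero_apply] at hx
    exact (div_eq_zero_iff.1 hx).resolve_right (by positivity)
  have hHc : Continuous fun x : ℝ => ((circleMap 0 1 x)⁻¹ * H (circleMap 0 1 x)).re := by
    have h := hH.continuousOn
    rw [closure_ball _ one_ne_zero] at h
    have h' : Continuous fun x : ℝ => H (circleMap 0 1 x) :=
      h.comp_continuous (continuous_circleMap 0 1) fun x => by simp
    exact Complex.continuous_re.comp (((continuous_circleMap 0 1).inv₀ fun x =>
      circleMap_ne_center one_ne_zero).mul h')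
  have hEq := Measure.eqOn_Icc_of_ae_eq volume (by positivity : (0 : ℝ) ≠ 2 * π)
    hae hHc.continuousOn continuousOn_const
  intro z hz
  have hzm : z ∈ circleMap 0 1 '' Set.Ioc 0 (2 * π) := by
    rw [image_circleMap_Ioc]; simpa using hz
  obtain ⟨x, hx, rfl⟩ := hzm
  exact hEq (Set.Ioc_subset_Icc_self hx)

/-- The complex bilinear pairing `∑ uⱼ vⱼ` on `ℂⁿ`. -/
def dotE {n : ℕ} (u v : EuclideanSpace ℂ (Fin n)) : ℂ := ∑ j, u j * v j

lemma dotE_add_right {n : ℕ} (u v w : EuclideanSpace ℂ (Fin n)) :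
    dotE u (v + w) = dotE u v + dotE u w := by
  simp [dotE, mul_add, Finset.sum_add_distrib]

lemma dotE_sub_right {n : ℕ} (u v w : EuclideanSpace ℂ (Fin n)) :
    dotE u (v - w) = dotE u v - dotE u w := by
  simp [dotE, mul_sub, Finset.sum_sub_distrib]

lemma dotE_smul_right {n : ℕ} (c : ℂ) (u v : EuclideanSpace ℂ (Fin n)) :
    dotE u (c • v) = c * dotE u v := by
  simp [dotE, Finset.mul_sum, mul_left_comm]

lemma conjVecE_apply {n : ℕ} (u : EuclideanSpace ℂ (Fin n)) (j : Fin n) :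
    conjVecE u j = conj (u j) := rfl

lemma norm_conjVecE {n : ℕ} (u : EuclideanSpace ℂ (Fin n)) : ‖conjVecE u‖ = ‖u‖ := by
  simp [EuclideanSpace.norm_eq, conjVecE_apply]

lemma dotE_conjVecE {n : ℕ} (u : EuclideanSpace ℂ (Fin n)) :
    dotE u (conjVecE u) = ((‖u‖ ^ 2 : ℝ) : ℂ) := by
  rw [EuclideanSpace.norm_sq_eq, dotE]
  push_cast
  exact Finset.sum_congr rfl fun j _ => by rw [conjVecE_apply, Complex.mul_conj']

lemma norm_dotE_le {n : ℕ} (u v : EuclideanSpace ℂ (Fin n)) : ‖dotE u v‖ ≤ ‖u‖ * ‖v‖ := by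
  have h : dotE u v = inner ℂ (conjVecE u) v := by
    simp [dotE, PiLp.inner_apply, conjVecE_apply, mul_comm]
  rw [h, ← norm_conjVecE u]
  exact norm_inner_le_norm _ _

lemma DiffContOnCl.dotE {n : ℕ} {u v : ℂ → EuclideanSpace ℂ (Fin n)} {s : Set ℂ}
    (hu : DiffContOnCl ℂ u s) (hv : DiffContOnCl ℂ v s) :
    DiffContOnCl ℂ (fun z => dotE (u z) (v z)) s := by
  have hp : ∀ j : Fin n, Differentiable ℂ fun x : EuclideanSpace ℂ (Fin n) => x j :=
    fun j => (EuclideanSpace.proj (𝕜 := ℂ) j).differentiable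
  constructor
  · exact DifferentiableOn.fun_sum fun j _ =>
      ((hp j).comp_differentiableOn hu.1).mul ((hp j).comp_differentiableOn hv.1)
  · exact continuousOn_finsetSum _ fun j _ =>
      ((hp j).continuous.comp_continuousOn hu.2).mul ((hp j).continuous.comp_continuousOn hv.2)

/-- The operator norm of a matrix is bounded by the sum of the norms of its entries. -/
lemma norm_toEuclideanLin_le {n : ℕ} (A : Matrix (Fin n) (Fin n) ℂ)
    (v : EuclideanSpace ℂ (Fin n)) :
    ‖Matrix.toEuclideanLin A v‖ ≤ (∑ i, ∑ j, ‖A i j‖) * ‖v‖ := by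
  have h : Matrix.toEuclideanLin A v =
      ∑ i, EuclideanSpace.single i (Matrix.toEuclideanLin A v i) := by
    ext k
    simp [Finset.sum_apply]
  rw [h, Finset.sum_mul]
  refine (norm_sum_le _ _).trans (Finset.sum_le_sum fun i _ => ?_)
  rw [PiLp.norm_single, Finset.sum_mul]
  have : Matrix.toEuclideanLin A v i = ∑ j, A i j * v j := by
    simp [Matrix.toLpLin_apply, Matrix.mulVec, dotProduct]
  rw [this]
  refine (norm_sum_le _ _).trans (Finset.sum_le_sum fun j _ => ?_)
  rw [norm_mul]
  exact mul_le_mul_of_nonneg_left (PiLp.norm_apply_le v j) (norm_nonneg _)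

lemma OHolder.diffContOnCl {F : Type*} [NormedAddCommGroup F] [NormedSpace ℂ F] {k : ℕ} {β : ℝ}
    {f : ℂ → F} (hf : OHolder k β f) : DiffContOnCl ℂ f (ball 0 1) :=
  ⟨hf.1, by rw [closure_ball _ one_ne_zero]; exact hf.2.1⟩

lemma OHolder.exists_norm_sub_le {F : Type*} [NormedAddCommGroup F] [NormedSpace ℂ F] {β : ℝ}
    {f : ℂ → F} (hβ : 0 ≤ β) (hf : OHolder 0 β f) :
    ∃ C : ℝ, 0 ≤ C ∧ ∀ z ∈ cDisc, ∀ w ∈ cDisc, ‖f z - f w‖ ≤ C * ‖z - w‖ ^ β := by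
  obtain ⟨C, hC⟩ := hf.2.2.2
  refine ⟨C, C.2, fun z hz w hw => ?_⟩
  have h := hC.dist_le hz hw
  rw [iteratedFDerivWithin_zero_eq_comp, Function.comp_apply, Function.comp_apply,
    LinearIsometryEquiv.dist_map, dist_eq_norm, dist_eq_norm, Real.coe_toNNReal _ hβ] at h
  exact h

/-- A map of class `C^{k,β}` on the unit circle is continuous there. -/
lemma CircleCk.exists_norm_sub_le {F : Type*} [NormedAddCommGroup F] [NormedSpace ℝ F] {k : ℕ}
    {β : ℝ} {f : ℂ → F} (hf : CircleCk k β f) {w : ℂ} (hw : ‖w‖ = 1) {ε : ℝ} (hε : 0 < ε) :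
    ∃ ρ > 0, ∀ z, ‖z‖ = 1 → ‖z - w‖ < ρ → ‖f z - f w‖ ≤ ε := by
  have hc : Continuous fun θ : ℝ => f (Complex.exp ((θ : ℂ) * Complex.I)) :=
    continuousOn_univ.1 hf.1.continuousOn
  have hww : w * conj w = 1 := by rw [Complex.mul_conj', hw]; simp
  have hexp : ∀ z, ‖z‖ = 1 →
      Complex.exp (((w.arg + (z * conj w).arg : ℝ) : ℂ) * Complex.I) = z := by
    intro z hz
    have e : ∀ u : ℂ, ‖u‖ = 1 → Complex.exp ((u.arg : ℂ) * Complex.I) = u := fun u hu => by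
      have := Complex.norm_mul_exp_arg_mul_I u
      rwa [hu, Complex.ofReal_one, one_mul] at this
    rw [Complex.ofReal_add, add_mul, Complex.exp_add, e w hw, e _ (by simp [hz, hw])]
    calc w * (z * conj w) = z * (w * conj w) := by ring
      _ = z := by rw [hww, mul_one]
  have harg : ContinuousAt (fun z : ℂ => w.arg + (z * conj w).arg) w := by
    refine continuousAt_const.add (ContinuousAt.comp (g := Complex.arg)
      (Complex.continuousAt_arg ?_) (by fun_prop))
    rw [hww]; exact Complex.one_mem_slitPlane
  have h := hc.continuousAt.comp harg
  obtain ⟨ρ, hρ, H⟩ := Metric.continuousAt_iff.1 h ε hε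
  refine ⟨ρ, hρ, fun z hz hzw => ?_⟩
  have := H (x := z) (by rwa [dist_eq_norm])
  simp only [Function.comp_apply] at this
  rw [hexp z hz, hexp w hw, dist_eq_norm] at this
  exact this.le

/-- Uniqueness for the homogeneous two-point Riemann–Hilbert problem with `H = Iₙ`. -/
theorem homogeneous_RH_two_points_uniqueness
    (n : ℕ) (hn : 1 ≤ n) (α : ℝ) (hα0 : 0 < α) (hα1 : α < 1)
    (S : ℂ → Matrix (Fin n) (Fin n) ℂ)
    (hSreg : ∀ i j, CircleCk 0 α (fun ζ => S ζ i j))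
    (hSymm : ∀ ζ ∈ uCircle, (S ζ).IsSymm)
    (hSnorm : ∀ ζ ∈ uCircle, ∀ v : EuclideanSpace ℂ (Fin n), v ≠ 0 →
      ‖Matrix.toEuclideanLin (S ζ) v‖ < ‖v‖)
    (ζ₀ ξ₀ : ℂ) (hζ₀ : ζ₀ ∈ uCircle) (hξ₀ : ξ₀ ∈ uCircle) (hne : ζ₀ ≠ ξ₀)
    (ψ : ℂ → EuclideanSpace ℂ (Fin n)) (hψ : OHolder 0 α ψ)
    (hz1 : ψ ζ₀ = 0) (hz2 : ψ ξ₀ = 0)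
    (hext : ∃ G : ℂ → EuclideanSpace ℂ (Fin n), OHolder 0 α G ∧ ∀ ζ ∈ uCircle,
      G ζ = conjVecE ((ζ⁻¹ : ℂ) • ψ ζ) + Matrix.toEuclideanLin (S ζ) ((ζ⁻¹ : ℂ) • ψ ζ)) :
    EqOn ψ 0 cDisc := by
  obtain ⟨G, hG, hGeq⟩ := hext
  have hmem : ∀ z : ℂ, ‖z‖ = 1 → z ∈ uCircle := fun z hz => by simpa [uCircle] using hz
  have hmem' : ∀ z : ℂ, ‖z‖ = 1 → z ∈ cDisc := fun z hz => by simp [cDisc, hz]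
  have hw₁ : ‖ζ₀‖ = 1 := by simpa [uCircle] using hζ₀
  have hw₂ : ‖ξ₀‖ = 1 := by simpa [uCircle] using hξ₀
  have hψd := hψ.diffContOnCl
  have hH : DiffContOnCl ℂ (fun z => dotE (ψ z) (G z)) (ball 0 1) := hψd.dotE hG.diffContOnCl
  have hT : ∀ z, ‖z‖ = 1 → ∀ v, ‖Matrix.toEuclideanLin (S z) v‖ ≤ ‖v‖ := fun z hz v => by
    by_cases hv : v = 0
    · simp [hv]
    · exact (hSnorm z (hmem z hz) v hv).le
  have hHeq : ∀ z, ‖z‖ = 1 → dotE (ψ z) (G z) =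
      z * ((‖ψ z‖ ^ 2 : ℝ) : ℂ) + z⁻¹ * dotE (ψ z) (Matrix.toEuclideanLin (S z) (ψ z)) := by
    intro z hz
    have hc : conjVecE (z⁻¹ • ψ z) = z • conjVecE (ψ z) := by
      ext j
      simp [conjVecE_apply, Complex.inv_eq_conj hz]
    rw [hGeq z (hmem z hz), hc, map_smul, dotE_add_right, dotE_smul_right, dotE_smul_right,
      dotE_conjVecE]
  have hBT : ∀ w, ‖w‖ = 1 → ∀ v, ‖dotE v (Matrix.toEuclideanLin (S w) v)‖ ≤ ‖v‖ ^ 2 :=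
    fun w hw v => (norm_dotE_le _ _).trans (by
      rw [sq]; exact mul_le_mul_of_nonneg_left (hT w hw v) (norm_nonneg v))
  have hHg : ∀ z, ‖z‖ = 1 → ‖dotE (ψ z) (G z)‖ ≤ 2 * ‖ψ z‖ ^ 2 := by
    intro z hz
    rw [hHeq z hz]
    refine (norm_add_le _ _).trans ?_
    rw [norm_mul, norm_mul, norm_inv, hz, inv_one, one_mul, one_mul, Complex.norm_real,
      Real.norm_of_nonneg (by positivity)]
    linarith [hBT z hz (ψ z)]
  have hψc : Continuous fun x : ℝ => ‖ψ (circleMap 0 1 x)‖ ^ 2 :=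
    ((hψ.2.1.comp_continuous (continuous_circleMap 0 1) fun x => by simp [cDisc]).norm).pow 2
  obtain ⟨C, hC0, hC⟩ := hψ.exists_norm_sub_le hα0.le
  have key : ∀ w, ‖w‖ = 1 → ψ w = 0 →
      CircleIntegrable (fun z => ‖ψ z‖ ^ 2 / ‖z - w‖ ^ 2) 0 1 := by
    intro w hw hψw
    let L : EuclideanSpace ℂ (Fin n) →L[ℂ] EuclideanSpace ℂ (Fin n) :=
      LinearMap.toContinuousLinearMap (Matrix.toEuclideanLin (S w))
    have hL : ∀ v, L v = Matrix.toEuclideanLin (S w) v := fun v => rfl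
    have hg : ∀ z, ‖z‖ = 1 → ‖ψ z‖ ^ 2 ≤ C ^ 2 * ‖z - w‖ ^ (2 * α) := by
      intro z hz
      have h := hC z (hmem' z hz) w (hmem' w hw)
      rw [hψw, sub_zero] at h
      calc ‖ψ z‖ ^ 2 ≤ (C * ‖z - w‖ ^ α) ^ 2 := by gcongr
        _ = _ := by
          rw [mul_pow, ← Real.rpow_natCast (‖z - w‖ ^ α), ← Real.rpow_mul (norm_nonneg _)]
          congr 2
          push_cast; ring
    have hB : ∀ z, ‖z‖ = 1 → ‖ψ z‖ ^ 2 ≤ C ^ 2 * 2 ^ (2 * α) := fun z hz => by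
      refine (hg z hz).trans ?_
      have : ‖z - w‖ ≤ 2 := (norm_sub_le z w).trans (by rw [hz, hw]; norm_num)
      gcongr
    have hf3 : ∀ z, ‖z‖ = 1 →
        ‖z * dotE (ψ z) (G z) - dotE (ψ z) (L (ψ z))‖ ≤ 3 * ‖ψ z‖ ^ 2 := fun z hz => by
      refine (norm_sub_le _ _).trans ?_
      rw [norm_mul, hz, one_mul, hL]
      linarith [hHg z hz, hBT w hw (ψ z)]
    refine circleIntegrable_div_norm_sub_sq hw
      (f := fun z => z * dotE (ψ z) (G z) - dotE (ψ z) (L (ψ z)))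
      ((differentiable_id.diffContOnCl.smul hH).sub
        (hψd.dotE (L.differentiable.comp_diffContOnCl hψd)))
      (g := fun z => ‖ψ z‖ ^ 2) (C := 3 * C ^ 2) (β := 2 * α) (M := 3 * (C ^ 2 * 2 ^ (2 * α)))
      (B := C ^ 2 * 2 ^ (2 * α)) (by positivity) ?_ ?_ (fun z _ => by positivity) hB hψc ?_
    · exact fun z hz => (hf3 z hz).trans (by linarith [hg z hz])
    · exact fun z hz => (hf3 z hz).trans (by linarith [hB z hz])
    · intro ε hε
      obtain ⟨δ, hδ, hδε⟩ : ∃ δ > 0, (∑ _i : Fin n, ∑ _j : Fin n, δ) ≤ ε / 2 := by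
        have hn0 : (0 : ℝ) < n := by exact_mod_cast hn
        refine ⟨ε / 2 / (n * n), by positivity, le_of_eq ?_⟩
        simp only [Finset.sum_const, Finset.card_univ, Fintype.card_fin, nsmul_eq_mul]
        field_simp
      choose ρ hρ hρS using fun i j => (hSreg i j).exists_norm_sub_le hw hδ
      have hev : ∀ᶠ t in 𝓝 (0 : ℝ), (∀ i j, t < ρ i j) ∧ t < ε / 2 :=
        (eventually_all.2 fun i => eventually_all.2 fun j => eventually_lt_nhds (hρ i j)).and
          (eventually_lt_nhds (by positivity))
      obtain ⟨r, hr, hrS⟩ := Metric.eventually_nhds_iff.1 hev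
      refine ⟨r, hr, fun z hz hzw => ?_⟩
      obtain ⟨h1, h2⟩ := hrS (y := ‖z - w‖) (by simpa using hzw)
      have hz0 : z ≠ 0 := norm_ne_zero_iff.1 (by rw [hz]; exact one_ne_zero)
      have hdec : z * dotE (ψ z) (G z) - dotE (ψ z) (L (ψ z)) - w * z * ((‖ψ z‖ ^ 2 : ℝ) : ℂ) =
          z * (z - w) * ((‖ψ z‖ ^ 2 : ℝ) : ℂ) +
            dotE (ψ z) (Matrix.toEuclideanLin (S z - S w) (ψ z)) := by
        rw [hHeq z hz, hL, map_sub, LinearMap.sub_apply, dotE_sub_right]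
        field_simp
        ring
      have hS : ‖dotE (ψ z) (Matrix.toEuclideanLin (S z - S w) (ψ z))‖ ≤
          ε / 2 * ‖ψ z‖ ^ 2 := by
        refine (norm_dotE_le _ _).trans ?_
        have : ‖Matrix.toEuclideanLin (S z - S w) (ψ z)‖ ≤ ε / 2 * ‖ψ z‖ := by
          refine (norm_toEuclideanLin_le _ _).trans ?_
          refine mul_le_mul_of_nonneg_right (le_trans ?_ hδε) (norm_nonneg _)
          exact Finset.sum_le_sum fun i _ => Finset.sum_le_sum fun j _ => hρS i j z hz (h1 i j)
        nlinarith [norm_nonneg (ψ z)]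
      show ‖z * dotE (ψ z) (G z) - dotE (ψ z) (L (ψ z)) - w * z * ((‖ψ z‖ ^ 2 : ℝ) : ℂ)‖ ≤
        ε * ‖ψ z‖ ^ 2
      rw [hdec]
      refine (norm_add_le _ _).trans ?_
      rw [norm_mul, norm_mul, hz, one_mul, Complex.norm_real,
        Real.norm_of_nonneg (by positivity : (0 : ℝ) ≤ ‖ψ z‖ ^ 2)]
      nlinarith [sq_nonneg ‖ψ z‖]
  have hre_ge : ∀ z, ‖z‖ = 1 →
      ‖ψ z‖ ^ 2 - ‖ψ z‖ * ‖Matrix.toEuclideanLin (S z) (ψ z)‖ ≤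
        (z⁻¹ * dotE (ψ z) (G z)).re := by
    intro z hz
    have hz0 : z ≠ 0 := norm_ne_zero_iff.1 (by rw [hz]; exact one_ne_zero)
    have h : z⁻¹ * dotE (ψ z) (G z) = ((‖ψ z‖ ^ 2 : ℝ) : ℂ) +
        z⁻¹ * (z⁻¹ * dotE (ψ z) (Matrix.toEuclideanLin (S z) (ψ z))) := by
      rw [hHeq z hz]
      field_simp
    have h' := Complex.abs_re_le_norm
      (z⁻¹ * (z⁻¹ * dotE (ψ z) (Matrix.toEuclideanLin (S z) (ψ z))))
    rw [norm_mul, norm_mul, norm_inv, hz, inv_one, one_mul, one_mul] at h'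
    rw [h, Complex.add_re, Complex.ofReal_re]
    linarith [(abs_le.1 h').1, norm_dotE_le (ψ z) (Matrix.toEuclideanLin (S z) (ψ z))]
  have hre0 := re_inv_mul_eq_zero hw₁ hw₂ hne hH hHg (key ζ₀ hw₁ hz1) (key ξ₀ hw₂ hz2)
    (by simp [hz1, dotE]) (by simp [hz2, dotE]) fun z hz => by
      refine le_trans ?_ (hre_ge z hz)
      nlinarith [norm_nonneg (ψ z), hT z hz (ψ z)]
  have hψ0 : ∀ z, ‖z‖ = 1 → ψ z = 0 := by
    intro z hz
    by_contra hv
    have h := hre_ge z hz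
    rw [hre0 z hz] at h
    nlinarith [hSnorm z (hmem z hz) (ψ z) hv, norm_pos_iff.2 hv]
  have hcl := Complex.eqOn_closure_of_eqOn_frontier isBounded_ball hψd
    (diffContOnCl_const (c := (0 : EuclideanSpace ℂ (Fin n)))) fun z hz => by
      rw [frontier_ball _ one_ne_zero] at hz
      exact hψ0 z (by simpa using hz)
  rw [closure_ball _ one_ne_zero] at hcl
  exact hcl
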